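/- In any 2-crossed module of groups (L, E, G, δ, ∂, ▷, {,}), the 1-functoriality identities hold: for every X ∈ G and e, f, g ∈ E, (i) (e f) ▷′ {f⁻¹ e⁻¹, X ▷ g}⁻¹ = ((e f) ▷′ {f⁻¹, (∂(e)⁻¹ X) ▷ g}⁻¹) · (e ▷′ {e⁻¹, X ▷ g}⁻¹), and (ii) e ▷′ {e⁻¹, (X ▷ f)(X ▷ g)}⁻¹ = (e ▷′ {e⁻¹, X ▷ f}⁻¹) · (((X ▷ f) e) ▷′ {e⁻¹, X ▷ g}⁻¹). -/

import Mathlib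

/-- A 2-crossed module of groups `(L, E, G, δ, ∂, ▷, {,})`.
`dl` is δ : L → E, `de` is ∂ : E → G, `actL`/`actE` are the left actions of `G`
on `L` and `E` by group automorphisms, and `pl` is the Peiffer lifting. -/
structure TwoCrossedModule (L E G : Type*) [Group L] [Group E] [Group G] where
  /-- δ : L → E -/
  dl : L →* E
  /-- ∂ : E → G -/
  de : E →* G
  /-- the action of G on L by automorphisms -/
  actL : G →* MulAut L
  /-- the action of G on E by automorphisms -/
  actE : G →* MulAut E
  /-- the Peiffer lifting {,} : E × E → L -/
  pl : E → E → L
  comp_triv : ∀ l : L, de (dl l) = 1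
  dl_equiv : ∀ (a : G) (l : L), dl (actL a l) = actE a (dl l)
  de_equiv : ∀ (a : G) (e : E), de (actE a e) = a * de e * a⁻¹
  pl_equiv : ∀ (a : G) (e f : E), actL a (pl e f) = pl (actE a e) (actE a f)
  ax_i : ∀ e f : E, dl (pl e f) = e * f * e⁻¹ * actE (de e) f⁻¹
  ax_ii : ∀ l k : L, pl (dl l) (dl k) = l * k * l⁻¹ * k⁻¹
  ax_iii : ∀ e f g : E, pl (e * f) g = pl e (f * g * f⁻¹) * actL (de e) (pl f g)
  ax_iv : ∀ e f g : E, pl e (f * g) =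
    pl e f * pl e g * pl (e * g * e⁻¹ * actE (de e) g⁻¹)⁻¹ (actE (de e) f)
  ax_v : ∀ (e : E) (l : L), pl (dl l) e * pl e (dl l) = l * actL (de e) l⁻¹

/-- The operation `e ▷′ l := l * {δ(l)⁻¹, e}`. -/
def TwoCrossedModule.tprime {L E G : Type*} [Group L] [Group E] [Group G]
    (M : TwoCrossedModule L E G) (e : E) (l : L) : L :=
  l * M.pl (M.dl l)⁻¹ e

namespace TwoCrossedModule

variable {L E G : Type*} [Group L] [Group E] [Group G] (M : TwoCrossedModule L E G)

/-- The action `▷′` of `im δ` on `L` is conjugation. -/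
lemma tprime_dl (m k : L) : M.tprime (M.dl m) k = m * k * m⁻¹ := by
  rw [tprime, ← map_inv, M.ax_ii]
  group

lemma pl_mul_right (e f g : E) :
    M.pl e (f * g) = M.pl e f * M.tprime (M.actE (M.de e) f) (M.pl e g) := by
  rw [tprime, M.ax_i, M.ax_iv, mul_assoc]

lemma actL_eq_tprime_mul (e : E) (l : L) :
    M.actL (M.de e) l = M.tprime e l * M.pl e (M.dl l)⁻¹ := by
  have h := M.ax_v e l⁻¹
  rw [map_inv, inv_inv] at h
  rw [tprime, mul_assoc, h, mul_inv_cancel_left]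

lemma tprime_eq (e : E) (l : L) :
    M.tprime e l = M.actL (M.de e) l * (M.pl e (M.dl l)⁻¹)⁻¹ := by
  rw [actL_eq_tprime_mul, mul_inv_cancel_right]

lemma tprime_mul (e : E) (l k : L) :
    M.tprime e (l * k) = M.tprime e l * M.tprime e k := by
  simp only [M.tprime_eq e]
  rw [map_mul, map_mul M.dl, mul_inv_rev, pl_mul_right, ← map_inv M.dl k, ← M.dl_equiv, tprime_dl,
    map_inv, map_inv]
  group

/-- The operation `e ▷′ ·` as an endomorphism of the group `L`. -/
def tprimeHom (e : E) : L →* L := MonoidHom.mk' (M.tprime e) (M.tprime_mul e)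

lemma tprime_inv (e : E) (l : L) : M.tprime e l⁻¹ = (M.tprime e l)⁻¹ :=
  map_inv (M.tprimeHom e) l

lemma mul_tprime (e f : E) (l : L) : M.tprime (e * f) l = M.tprime e (M.tprime f l) := by
  have h := M.pl_mul_right (M.dl l)⁻¹ e f
  rw [map_inv, M.comp_triv, inv_one, map_one, MulAut.one_apply] at h
  conv_rhs => rw [tprime.eq_def M f, tprime_mul]
  rw [tprime, h, ← mul_assoc, ← tprime]

lemma one_tprime (l : L) : M.tprime 1 l = l := by
  simpa using M.tprime_dl 1 l

/-- The Peiffer lifting of a product in the left variable, in terms of `▷′`. -/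
lemma pl_mul_left (e f g : E) :
    M.pl (e * f) g =
      M.tprime e (M.pl f g) * M.pl e (M.actE (M.de f) g) := by
  have h : f * g * f⁻¹ = M.dl (M.pl f g) * M.actE (M.de f) g := by
    rw [M.ax_i, map_inv, inv_mul_cancel_right]
  have hact := M.actL_eq_tprime_mul e (M.pl f g)⁻¹
  rw [map_inv, map_inv, inv_inv, tprime_inv, eq_inv_mul_iff_mul_eq] at hact
  rw [M.ax_iii, h, pl_mul_right, ← M.dl_equiv, tprime_dl, ← hact]
  group

end TwoCrossedModule

/-- The 1-functoriality identities: for every `X ∈ G` and `e, f, g ∈ E`,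
(i) `(e f) ▷′ {f⁻¹ e⁻¹, X ▷ g}⁻¹
     = ((e f) ▷′ {f⁻¹, (∂(e)⁻¹ X) ▷ g}⁻¹) · (e ▷′ {e⁻¹, X ▷ g}⁻¹)` and
(ii) `e ▷′ {e⁻¹, (X ▷ f)(X ▷ g)}⁻¹
     = (e ▷′ {e⁻¹, X ▷ f}⁻¹) · (((X ▷ f) e) ▷′ {e⁻¹, X ▷ g}⁻¹)`. -/
theorem one_functoriality {L E G : Type*} [Group L] [Group E] [Group G]
    (M : TwoCrossedModule L E G) :
    ∀ (X : G) (e f g : E),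
      (M.tprime (e * f) (M.pl (f⁻¹ * e⁻¹) (M.actE X g))⁻¹ =
        M.tprime (e * f) (M.pl f⁻¹ (M.actE ((M.de e)⁻¹ * X) g))⁻¹ *
          M.tprime e (M.pl e⁻¹ (M.actE X g))⁻¹) ∧
      (M.tprime e (M.pl e⁻¹ (M.actE X f * M.actE X g))⁻¹ =
        M.tprime e (M.pl e⁻¹ (M.actE X f))⁻¹ *
          M.tprime (M.actE X f * e) (M.pl e⁻¹ (M.actE X g))⁻¹) := by
  intro X e f g
  constructor
  · rw [M.pl_mul_left, mul_inv_rev, M.tprime_mul, ← M.tprime_inv, M.mul_tprime e f (M.tprime _ _),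
      ← M.mul_tprime f, mul_inv_cancel, M.one_tprime, map_inv, map_mul, MulAut.mul_apply]
  · have h : M.actE X f * e = e * (M.dl (M.pl e⁻¹ (M.actE X f)) *
        M.actE (M.de e⁻¹) (M.actE X f)) := by
      rw [M.ax_i, map_inv (M.actE _)]
      group
    rw [h, M.mul_tprime e, ← M.tprime_mul, M.mul_tprime (M.dl _), M.tprime_dl, M.pl_mul_right,
      mul_inv_rev, M.tprime_inv (M.actE _ _)]
    congr 1
    group
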